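/- arXiv:2405.16543 — 2 statements merged into one kernel-verified Lean document; each statement's English description precedes it below -/
import Mathlib

section
/- Let K ∈ ℝ^{m×n} and suppose there exist N ≥ 1 and symmetric positive definite matrices P^w ∈ ℝ^{n×n} for every word w of depth at most N−1, with P^∅ = P₀, such that P^w ≻ (Ā_i + B̄_i K)ᵀ P^{w·i} (Ā_i + B̄_i K) for every word w of depth at most N−2 and every i ∈ {1,…,d}, and P^w ≻ (Ā_i + B̄_i K)ᵀ P₀ (Ā_i + B̄_i K) for every word w of depth exactly N−1 and every i ∈ {1,…,d}. Then for every word w = (i₁,…,i_N) of depth N, the product Ψ^w = (Ā_{i_N} + B̄_{i_N} K) ⋯ (Ā_{i₂} + B̄_{i₂} K)(Ā_{i₁} + B̄_{i₁} K) satisfies P₀ ≻ Ψ^wᵀ P₀ Ψ^w. -/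
open Matrix

/-- The scenario product along a word `w` of depth `t` for the closed loop with
gains `K`: the product of the vertex matrices `Ā_{i_k} + B̄_{i_k} K^{(i₁,…,i_{k−1})}`,
latest factor on the left. -/
noncomputable def scenProd {n m d : ℕ}
    (Abar : Fin d → Matrix (Fin n) (Fin n) ℝ)
    (Bbar : Fin d → Matrix (Fin n) (Fin m) ℝ)
    (K : ∀ t : ℕ, (Fin t → Fin d) → Matrix (Fin m) (Fin n) ℝ) :
    ∀ t : ℕ, (Fin t → Fin d) → Matrix (Fin n) (Fin n) ℝ
  | 0, _ => 1
  | t + 1, w =>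
      (Abar (w (Fin.last t)) + Bbar (w (Fin.last t)) * K t (Fin.init w)) *
        scenProd Abar Bbar K t (Fin.init w)

/-- A strict Lyapunov decrease along every edge of the scenario tree up to depth `t + 1`
accumulates to a strict decrease along the scenario product. -/
theorem posDef_sub_scenProd {n m d : ℕ}
    (Abar : Fin d → Matrix (Fin n) (Fin n) ℝ)
    (Bbar : Fin d → Matrix (Fin n) (Fin m) ℝ)
    (K : ∀ t : ℕ, (Fin t → Fin d) → Matrix (Fin m) (Fin n) ℝ)
    (Q : ∀ t : ℕ, (Fin t → Fin d) → Matrix (Fin n) (Fin n) ℝ)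
    (t : ℕ)
    (h : ∀ s ≤ t, ∀ (w : Fin s → Fin d) (i : Fin d),
      (Q s w - (Abar i + Bbar i * K s w)ᵀ * Q (s + 1) (Fin.snoc w i) *
        (Abar i + Bbar i * K s w)).PosDef)
    (w : Fin (t + 1) → Fin d) :
    (Q 0 Fin.elim0 - (scenProd Abar Bbar K (t + 1) w)ᵀ * Q (t + 1) w *
      scenProd Abar Bbar K (t + 1) w).PosDef := by
  induction t with
  | zero =>
    have hw := h 0 le_rfl (Fin.init w) (w (Fin.last 0))
    rw [Fin.snoc_init_self] at hw
    simpa [scenProd, Subsingleton.elim (Fin.init w) Fin.elim0] using hw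
  | succ t ih =>
    have hw := h (t + 1) le_rfl (Fin.init w) (w (Fin.last (t + 1)))
    rw [Fin.snoc_init_self] at hw
    have hprefix := ih (fun s hs => h s (hs.trans t.le_succ)) (Fin.init w)
    have hstep := hw.posSemidef.conjTranspose_mul_mul_same
      (scenProd Abar Bbar K (t + 1) (Fin.init w))
    rw [conjTranspose_eq_transpose_of_trivial] at hstep
    convert hprefix.add_posSemidef hstep using 1
    rw [scenProd, transpose_mul]
    noncomm_ring

theorem stmt_12 (n m d : ℕ) (hn : 0 < n) (hm : 0 < m) (hd : 0 < d)
    (Abar : Fin d → Matrix (Fin n) (Fin n) ℝ)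
    (Bbar : Fin d → Matrix (Fin n) (Fin m) ℝ)
    (K : Matrix (Fin m) (Fin n) ℝ)
    (N : ℕ) (hN : 1 ≤ N)
    (P0 : Matrix (Fin n) (Fin n) ℝ)
    (P : ∀ t : ℕ, (Fin t → Fin d) → Matrix (Fin n) (Fin n) ℝ)
    (hP0 : ∀ w : Fin 0 → Fin d, P 0 w = P0)
    (hPpos : ∀ t, t < N → ∀ w : Fin t → Fin d, (P t w).PosDef)
    (h1 : ∀ t, t + 2 ≤ N → ∀ (w : Fin t → Fin d) (i : Fin d),
      (P t w - (Abar i + Bbar i * K)ᵀ * P (t + 1) (Fin.snoc w i) *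
        (Abar i + Bbar i * K)).PosDef)
    (h2 : ∀ (w : Fin (N - 1) → Fin d) (i : Fin d),
      (P (N - 1) w - (Abar i + Bbar i * K)ᵀ * P0 * (Abar i + Bbar i * K)).PosDef) :
    ∀ w : Fin N → Fin d,
      (P0 - (scenProd Abar Bbar (fun _ _ => K) N w)ᵀ * P0 *
        scenProd Abar Bbar (fun _ _ => K) N w).PosDef := by
  obtain ⟨M, rfl⟩ : ∃ M, N = M + 1 := ⟨N - 1, by omega⟩
  intro w
  have key := posDef_sub_scenProd Abar Bbar (fun _ _ => K)
    (fun t w => if t < M + 1 then P t w else P0) M ?_ w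
  · simpa [hP0] using key
  · intro s hs v i
    rcases hs.lt_or_eq with hlt | rfl
    · simpa [hlt, Nat.lt_succ_of_lt hlt] using h1 s (by omega) v i
    · simpa using h2 v i
end

section
/- Let F ∈ ℝ^{q×n} and E ∈ ℝ^{q×m} define the mixed constraint F x + E u ≤ 1 (componentwise, with 1 the all-ones vector in ℝ^q). Suppose there exist N ≥ 1, matrices G ∈ ℝ^{n×n} and L ∈ ℝ^{m×n}, and symmetric positive definite matrices S^w ∈ ℝ^{n×n} for every word w of depth at most N−1 (write S₀ = S^∅), such that: (i) the 2n×2n block matrices [[Gᵀ + G − S^w, (Ā_i G + B̄_i L)ᵀ], [Ā_i G + B̄_i L, S^{w·i}]] are positive definite for every word w of depth at most N−2 and every i ∈ {1,…,d}; (ii) the block matrices [[Gᵀ + G − S^w, (Ā_i G + B̄_i L)ᵀ], [Ā_i G + B̄_i L, S₀]] are positive definite for every word w of depth exactly N−1 and every i ∈ {1,…,d}; (iii) there exist symmetric matrices H^w ∈ ℝ^{q×q} for every word w of depth at most N−1 such that the (q+n)×(q+n) block matrices [[H^w, F G + E L], [(F G + E L)ᵀ, Gᵀ + G − S^w]] are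 positive semidefinite and every diagonal entry of every H^w is at most 1. Then G is invertible and, setting K = L G⁻¹ and P₀ = S₀⁻¹: for every x₀ with x₀ᵀ P₀ x₀ ≤ 1 and every admissible uncertainty sequence, the closed-loop trajectory x_{t+1} = (A_t + B_t K) x_t with inputs u_t = K x_t satisfies F x_t + E u_t ≤ 1 for all t ∈ ℕ and x_Nᵀ P₀ x_N ≤ 1 (so the ellipsoid {x : xᵀ P₀ x ≤ 1} is robust periodic invariant with period N); moreover there exist c ≥ 1 and λ ∈ (0,1) with ‖x_t‖ ≤ c λ^t ‖x₀‖ for all t ∈ ℕ. -/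
open Matrix

/-- Euclidean norm on `Fin n → ℝ`. -/
noncomputable def eNorm {n : ℕ} (x : Fin n → ℝ) : ℝ := Real.sqrt (∑ i, x i ^ 2)

section QuadraticForms

lemma convex_setOf_posDef {n : Type*} : Convex ℝ {T : Matrix n n ℝ | T.PosDef} := by
  rintro A (hA : A.PosDef) B (hB : B.PosDef) a b ha hb hab
  rcases ha.eq_or_lt with rfl | ha
  · obtain rfl : b = 1 := by linarith
    simpa using hB
  · exact (hA.smul ha).add_posSemidef (hB.posSemidef.smul hb)

variable {n m : Type*} [Fintype n] [Fintype m]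

lemma sumElim_dotProduct_fromBlocks_mulVec_sumElim (A : Matrix m m ℝ) (B : Matrix n m ℝ)
    (D : Matrix n n ℝ) (y : m → ℝ) (v : n → ℝ) :
    Sum.elim y v ⬝ᵥ fromBlocks A Bᵀ B D *ᵥ Sum.elim y v =
      y ⬝ᵥ A *ᵥ y + 2 * (v ⬝ᵥ B *ᵥ y) + v ⬝ᵥ D *ᵥ v := by
  have h : y ⬝ᵥ Bᵀ *ᵥ v = v ⬝ᵥ B *ᵥ y := by
    rw [mulVec_transpose, dotProduct_comm, ← dotProduct_mulVec]
  rw [fromBlocks_mulVec, sumElim_dotProduct_sumElim]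
  simp only [Sum.elim_comp_inl, Sum.elim_comp_inr, dotProduct_add, h]
  ring

lemma dotProduct_transpose_add_sub_mulVec (G T : Matrix n n ℝ) (y : n → ℝ) :
    y ⬝ᵥ (Gᵀ + G - T) *ᵥ y = 2 * (y ⬝ᵥ G *ᵥ y) - y ⬝ᵥ T *ᵥ y := by
  have h : y ⬝ᵥ Gᵀ *ᵥ y = y ⬝ᵥ G *ᵥ y := by
    rw [mulVec_transpose, dotProduct_comm, ← dotProduct_mulVec]
  simp only [sub_mulVec, add_mulVec, dotProduct_sub, dotProduct_add, h]
  ring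

/-- A quadratic form is bounded by a multiple of the squared Euclidean norm. -/
lemma exists_dotProduct_mulVec_le (M : Matrix n n ℝ) :
    ∃ C : ℝ, 0 < C ∧ ∀ x : n → ℝ, x ⬝ᵥ M *ᵥ x ≤ C * (x ⬝ᵥ x) := by
  refine ⟨1 + ∑ i, ∑ j, |M i j|, by positivity, fun x => ?_⟩
  have hx (i : n) : x i ^ 2 ≤ x ⬝ᵥ x := by
    simpa [dotProduct, sq] using
      Finset.single_le_sum (f := fun i => x i * x i) (fun i _ => mul_self_nonneg (x i))
        (Finset.mem_univ i)
  have hterm (i j : n) : x i * (M i j * x j) ≤ |M i j| * (x ⬝ᵥ x) := by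
    calc x i * (M i j * x j) ≤ |x i * (M i j * x j)| := le_abs_self _
      _ = |M i j| * |x i * x j| := by rw [← abs_mul]; congr 1; ring
      _ ≤ |M i j| * (x ⬝ᵥ x) := by
        refine mul_le_mul_of_nonneg_left (abs_le.2 ⟨?_, ?_⟩) (abs_nonneg _)
        · nlinarith [hx i, hx j, sq_nonneg (x i + x j)]
        · nlinarith [hx i, hx j, sq_nonneg (x i - x j)]
  have h0 : 0 ≤ x ⬝ᵥ x := Finset.sum_nonneg fun i _ => mul_self_nonneg (x i)
  calc x ⬝ᵥ M *ᵥ x = ∑ i, ∑ j, x i * (M i j * x j) := by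
        simp only [dotProduct, mulVec, Finset.mul_sum]
    _ ≤ ∑ i, ∑ j, |M i j| * (x ⬝ᵥ x) :=
        Finset.sum_le_sum fun i _ => Finset.sum_le_sum fun j _ => hterm i j
    _ = (∑ i, ∑ j, |M i j|) * (x ⬝ᵥ x) := by simp only [Finset.sum_mul]
    _ ≤ _ := by nlinarith

variable [DecidableEq n]

/-- Fenchel–Young inequality for the quadratic forms of `T` and `T⁻¹`. -/
lemma two_mul_dotProduct_sub_le_inv {T : Matrix n n ℝ} (hT : T.PosDef) (v x : n → ℝ) :
    2 * (v ⬝ᵥ x) - v ⬝ᵥ T *ᵥ v ≤ x ⬝ᵥ T⁻¹ *ᵥ x := by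
  have hdet : IsUnit T.det := (isUnit_iff_isUnit_det _).1 hT.isUnit
  have h := hT.posSemidef.dotProduct_mulVec_nonneg (v - T⁻¹ *ᵥ x)
  have hTT : T *ᵥ T⁻¹ *ᵥ x = x := by rw [mulVec_mulVec, mul_nonsing_inv _ hdet, one_mulVec]
  have hsym : Tᵀ = T := by simpa using hT.isHermitian.eq
  have hcross : (T⁻¹ *ᵥ x) ⬝ᵥ T *ᵥ v = v ⬝ᵥ x := by
    rw [dotProduct_mulVec, ← mulVec_transpose, hsym, hTT, dotProduct_comm]
  simp only [star_trivial, mulVec_sub, sub_dotProduct, dotProduct_sub, hTT, hcross] at h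
  rw [dotProduct_comm (T⁻¹ *ᵥ x) x] at h
  linarith

lemma dotProduct_self_le_of_inv {T : Matrix n n ℝ} (hT : T.PosDef) {C : ℝ} (hC : 0 < C)
    (h : ∀ x : n → ℝ, x ⬝ᵥ T *ᵥ x ≤ C * (x ⬝ᵥ x)) (x : n → ℝ) :
    x ⬝ᵥ x ≤ C * (x ⬝ᵥ T⁻¹ *ᵥ x) := by
  have h1 := two_mul_dotProduct_sub_le_inv hT (C⁻¹ • x) x
  have h2 := h (C⁻¹ • x)
  simp only [smul_dotProduct, dotProduct_smul, mulVec_smul, smul_eq_mul] at h1 h2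
  have h3 : C * (C⁻¹ * (C⁻¹ * (x ⬝ᵥ x))) = C⁻¹ * (x ⬝ᵥ x) := by field_simp
  have h4 : C⁻¹ * (x ⬝ᵥ x) ≤ x ⬝ᵥ T⁻¹ *ᵥ x := by linarith
  rwa [inv_mul_le_iff₀ hC] at h4

lemma Matrix.PosDef.exists_mul_dotProduct_self_le {M : Matrix n n ℝ} (hM : M.PosDef) :
    ∃ ε : ℝ, 0 < ε ∧ ∀ x : n → ℝ, ε * (x ⬝ᵥ x) ≤ x ⬝ᵥ M *ᵥ x := by
  obtain ⟨C, hC, h⟩ := exists_dotProduct_mulVec_le M⁻¹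
  have hdet : IsUnit M.det := (isUnit_iff_isUnit_det _).1 hM.isUnit
  refine ⟨C⁻¹, inv_pos.2 hC, fun x => ?_⟩
  have := dotProduct_self_le_of_inv hM.inv hC h x
  rw [nonsing_inv_nonsing_inv _ hdet] at this
  rwa [inv_mul_le_iff₀ hC]

end QuadraticForms

section Lyapunov

variable {n : Type*} [Fintype n]

/-- The dilated Lyapunov inequality with contraction factor `ρ`, for the step from the shape
matrix `T` to the shape matrix `T'` under the closed-loop matrix `M * G⁻¹`. -/
def DilatedLyapunov (G : Matrix n n ℝ) (ρ : ℝ) (M T T' : Matrix n n ℝ) : Prop :=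
  ∀ y v : n → ℝ, 0 ≤ 2 * (y ⬝ᵥ G *ᵥ y) - y ⬝ᵥ T *ᵥ y + 2 * (v ⬝ᵥ M *ᵥ y) + ρ * (v ⬝ᵥ T' *ᵥ v)

variable {G M T T' : Matrix n n ℝ} {ρ : ℝ}

open Filter Topology in
lemma eventually_dilatedLyapunov [DecidableEq n]
    (h : (fromBlocks (Gᵀ + G - T) Mᵀ M T').PosDef) :
    ∀ᶠ δ in 𝓝[>] (0 : ℝ), DilatedLyapunov G (1 - δ) M T T' := by
  obtain ⟨ε, hε, hlow⟩ := h.exists_mul_dotProduct_self_le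
  obtain ⟨C, hC, hup⟩ := exists_dotProduct_mulVec_le T'
  filter_upwards [Ioo_mem_nhdsGT (show (0 : ℝ) < ε / C by positivity)] with δ hδ y v
  have h1 := hlow (Sum.elim y v)
  rw [sumElim_dotProduct_fromBlocks_mulVec_sumElim, dotProduct_transpose_add_sub_mulVec,
    sumElim_dotProduct_sumElim] at h1
  have hy : 0 ≤ y ⬝ᵥ y := Finset.sum_nonneg fun i _ => mul_self_nonneg (y i)
  have hv : 0 ≤ v ⬝ᵥ v := Finset.sum_nonneg fun i _ => mul_self_nonneg (v i)
  have h2 : δ * C ≤ ε := ((lt_div_iff₀ hC).1 hδ.2).le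
  have h3 := mul_le_mul_of_nonneg_left (hup v) hδ.1.le
  have h4 := mul_le_mul_of_nonneg_right h2 hv
  have h5 := mul_nonneg hε.le hy
  nlinarith

lemma DilatedLyapunov.sum {ι : Type*} [Fintype ι] {α : ι → ℝ} (hα : ∀ i, 0 ≤ α i)
    (hsum : ∑ i, α i = 1) {M' D : ι → Matrix n n ℝ}
    (h : ∀ i, DilatedLyapunov G ρ (M' i) T (D i)) :
    DilatedLyapunov G ρ (∑ i, α i • M' i) T (∑ i, α i • D i) := by
  intro y v
  have key := Finset.sum_nonneg fun i (_ : i ∈ Finset.univ) => mul_nonneg (hα i) (h i y v)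
  refine key.trans_eq ?_
  simp only [mul_add, mul_sub, Finset.sum_add_distrib, Finset.sum_sub_distrib, ← Finset.sum_mul,
    hsum, one_mul, sum_mulVec, dotProduct_sum, smul_mulVec, dotProduct_smul, smul_eq_mul,
    Finset.mul_sum, mul_left_comm]

lemma DilatedLyapunov.exists_of_mem_convexHull {s t : Set (Matrix n n ℝ)} (ht : Convex ℝ t)
    (h : ∀ T ∈ s, ∃ T' ∈ t, DilatedLyapunov G ρ M T T') (hT : T ∈ convexHull ℝ s) :
    ∃ T' ∈ t, DilatedLyapunov G ρ M T T' := by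
  refine convexHull_min (t := {T | ∃ T' ∈ t, DilatedLyapunov G ρ M T T'}) h ?_ hT
  rintro A ⟨A', hA', hA⟩ B ⟨B', hB', hB⟩ a b ha hb hab
  refine ⟨a • A' + b • B', ht hA' hB' ha hb hab, fun y v => ?_⟩
  have key := add_nonneg (mul_nonneg ha (hA y v)) (mul_nonneg hb (hB y v))
  obtain rfl : b = 1 - a := by linarith
  simp only [add_mulVec, smul_mulVec, dotProduct_add, dotProduct_smul, smul_eq_mul]
  linarith

lemma DilatedLyapunov.inv_le [DecidableEq n] (h : DilatedLyapunov G ρ M T T') (hρ : 0 < ρ)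
    (hT : T.PosDef) (hT' : T'.PosDef) (y : n → ℝ) :
    (M *ᵥ y) ⬝ᵥ T'⁻¹ *ᵥ (M *ᵥ y) ≤ ρ * ((G *ᵥ y) ⬝ᵥ T⁻¹ *ᵥ (G *ᵥ y)) := by
  have hdet : IsUnit T'.det := (isUnit_iff_isUnit_det _).1 hT'.isUnit
  set z := M *ᵥ y with hz
  have h1 := h y (-ρ⁻¹ • T'⁻¹ *ᵥ z)
  have hTT : T' *ᵥ T'⁻¹ *ᵥ z = z := by rw [mulVec_mulVec, mul_nonsing_inv _ hdet, one_mulVec]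
  rw [← hz] at h1
  simp only [mulVec_smul, hTT, smul_dotProduct, dotProduct_smul, smul_eq_mul,
    dotProduct_comm (T'⁻¹ *ᵥ z) z] at h1
  have h2 := two_mul_dotProduct_sub_le_inv hT y (G *ᵥ y)
  have h3 : ρ * (-ρ⁻¹ * (-ρ⁻¹ * (z ⬝ᵥ T'⁻¹ *ᵥ z))) = ρ⁻¹ * (z ⬝ᵥ T'⁻¹ *ᵥ z) := by field_simp
  rw [← inv_mul_le_iff₀ hρ]
  linarith

end Lyapunov

lemma eNorm_eq_sqrt_dotProduct {n : ℕ} (x : Fin n → ℝ) : eNorm x = √(x ⬝ᵥ x) := by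
  simp [eNorm, dotProduct, sq]

theorem stmt_14 (n m d q : ℕ) (hn : 0 < n) (hm : 0 < m) (hd : 0 < d) (hq : 0 < q)
    (Abar : Fin d → Matrix (Fin n) (Fin n) ℝ)
    (Bbar : Fin d → Matrix (Fin n) (Fin m) ℝ)
    (F : Matrix (Fin q) (Fin n) ℝ) (E : Matrix (Fin q) (Fin m) ℝ)
    (N : ℕ) (hN : 1 ≤ N)
    (G : Matrix (Fin n) (Fin n) ℝ) (L : Matrix (Fin m) (Fin n) ℝ)
    (S : ∀ t : ℕ, (Fin t → Fin d) → Matrix (Fin n) (Fin n) ℝ)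
    (hSpos : ∀ t, t < N → ∀ w : Fin t → Fin d, (S t w).PosDef)
    -- (i) the stability LMIs
    (h1 : ∀ t, t + 2 ≤ N → ∀ (w : Fin t → Fin d) (i : Fin d),
      (fromBlocks (Gᵀ + G - S t w) (Abar i * G + Bbar i * L)ᵀ
        (Abar i * G + Bbar i * L) (S (t + 1) (Fin.snoc w i))).PosDef)
    -- (ii) the wrap-around LMIs
    (h2 : ∀ (w : Fin (N - 1) → Fin d) (i : Fin d),
      (fromBlocks (Gᵀ + G - S (N - 1) w) (Abar i * G + Bbar i * L)ᵀ
        (Abar i * G + Bbar i * L) (S 0 Fin.elim0)).PosDef)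
    -- (iii) the constraint LMIs
    (H : ∀ t : ℕ, (Fin t → Fin d) → Matrix (Fin q) (Fin q) ℝ)
    (hHsym : ∀ t, t < N → ∀ w : Fin t → Fin d, (H t w).IsHermitian)
    (h3 : ∀ t, t < N → ∀ w : Fin t → Fin d,
      (fromBlocks (H t w) (F * G + E * L)
        (F * G + E * L)ᵀ (Gᵀ + G - S t w)).PosSemidef)
    (h4 : ∀ t, t < N → ∀ (w : Fin t → Fin d) (j : Fin q), H t w j j ≤ 1) :
    IsUnit G ∧
    -- constraint satisfaction and robust periodic invariance of the ellipsoid of `P₀ = S₀⁻¹`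
    (∀ (α : ℕ → Fin d → ℝ), (∀ t i, 0 ≤ α t i) → (∀ t, ∑ i, α t i = 1) →
      ∀ x : ℕ → Fin n → ℝ,
        (∀ t, x (t + 1) =
          ((∑ i, α t i • Abar i) + (∑ i, α t i • Bbar i) * (L * G⁻¹)).mulVec (x t)) →
        x 0 ⬝ᵥ (S 0 Fin.elim0)⁻¹.mulVec (x 0) ≤ 1 →
        (∀ (t : ℕ) (j : Fin q),
          (F.mulVec (x t) + E.mulVec ((L * G⁻¹).mulVec (x t))) j ≤ 1) ∧
        x N ⬝ᵥ (S 0 Fin.elim0)⁻¹.mulVec (x N) ≤ 1) ∧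
    -- robust exponential stability
    (∃ c : ℝ, 1 ≤ c ∧ ∃ lam : ℝ, lam ∈ Set.Ioo (0 : ℝ) 1 ∧
      ∀ (α : ℕ → Fin d → ℝ), (∀ t i, 0 ≤ α t i) → (∀ t, ∑ i, α t i = 1) →
      ∀ x : ℕ → Fin n → ℝ,
        (∀ t, x (t + 1) =
          ((∑ i, α t i • Abar i) + (∑ i, α t i • Bbar i) * (L * G⁻¹)).mulVec (x t)) →
        x 0 ⬝ᵥ (S 0 Fin.elim0)⁻¹.mulVec (x 0) ≤ 1 →
        ∀ t, eNorm (x t) ≤ c * lam ^ t * eNorm (x 0)) := by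
  classical
  set M : Fin d → Matrix (Fin n) (Fin n) ℝ := fun i => Abar i * G + Bbar i * L with hM
  set hull : ℕ → Set (Matrix (Fin n) (Fin n) ℝ) := fun k => convexHull ℝ (Set.range (S k))
    with hhull
  -- invertibility of `G`
  have hG : IsUnit G := by
    refine mulVec_injective_iff_isUnit.1 ((injective_iff_map_eq_zero G.mulVecLin).2 fun y hy => ?_)
    by_contra hy0
    have hy' : G *ᵥ y = 0 := hy
    have hne : (Sum.elim y 0 : Fin n ⊕ Fin n → ℝ) ≠ 0 := fun h0 =>
      hy0 (funext fun i => by simpa using congrFun h0 (Sum.inl i))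
    have h := (h2 (fun _ => ⟨0, hd⟩) ⟨0, hd⟩).dotProduct_mulVec_pos hne
    rw [star_trivial, sumElim_dotProduct_fromBlocks_mulVec_sumElim,
      dotProduct_transpose_add_sub_mulVec, hy'] at h
    have hS := (hSpos (N - 1) (by omega) (fun _ => ⟨0, hd⟩)).dotProduct_mulVec_pos hy0
    simp only [star_trivial, dotProduct_zero, zero_dotProduct] at h hS
    linarith
  have hGdet : IsUnit G.det := (isUnit_iff_isUnit_det _).1 hG
  have hGinv (x : Fin n → ℝ) : G *ᵥ G⁻¹ *ᵥ x = x := by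
    rw [mulVec_mulVec, mul_nonsing_inv _ hGdet, one_mulVec]
  have hull_posDef (k : ℕ) (hk : k < N) (T) (hT : T ∈ hull k) : T.PosDef :=
    convexHull_min (Set.range_subset_iff.2 (hSpos k hk)) convex_setOf_posDef hT
  have hull_zero (T) (hT : T ∈ hull 0) : T = S 0 Fin.elim0 := by
    simp only [hhull] at hT
    rw [Set.range_unique, convexHull_singleton, Set.mem_singleton_iff] at hT
    rw [hT]
    exact congrArg _ (Subsingleton.elim _ _)
  have mem_hull_zero : S 0 Fin.elim0 ∈ hull 0 := subset_convexHull ℝ _ ⟨_, rfl⟩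
  -- a uniform contraction factor, and a uniform upper bound on the shape matrices
  obtain ⟨δ, ⟨hδ0, hδ1⟩, hδ⟩ : ∃ δ : ℝ, δ ∈ Set.Ioo (0 : ℝ) 1 ∧
      ∀ (k : Fin N) (w : Fin k → Fin d) (i : Fin d),
        DilatedLyapunov G (1 - δ) (M i) (S k w)
          (if (k : ℕ) + 1 < N then S (k + 1) (Fin.snoc w i) else S 0 Fin.elim0) := by
    refine (Filter.Eventually.and (f := nhdsWithin (0 : ℝ) (Set.Ioi 0))
      (Ioo_mem_nhdsGT one_pos) ?_).exists
    rw [Filter.eventually_all]; intro k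
    rw [Filter.eventually_all]; intro w
    rw [Filter.eventually_all]; intro i
    refine eventually_dilatedLyapunov ?_
    split_ifs with hk
    · exact h1 k (by omega) w i
    · obtain ⟨k, hkN⟩ := k
      obtain rfl : k = N - 1 := by simp only at hk; omega
      exact h2 w i
  obtain ⟨C, hC0, hC⟩ : ∃ C : ℝ, 0 < C ∧ ∀ (k : Fin N) (w : Fin k → Fin d) (x : Fin n → ℝ),
      x ⬝ᵥ S k w *ᵥ x ≤ C * (x ⬝ᵥ x) := by
    suffices h : ∀ᶠ C : ℝ in Filter.atTop, ∀ (k : Fin N) (w : Fin k → Fin d) (x : Fin n → ℝ),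
        x ⬝ᵥ S k w *ᵥ x ≤ C * (x ⬝ᵥ x) from ((Filter.eventually_gt_atTop 0).and h).exists
    rw [Filter.eventually_all]; intro k
    rw [Filter.eventually_all]; intro w
    obtain ⟨C, -, hC⟩ := exists_dotProduct_mulVec_le (S k w)
    filter_upwards [Filter.eventually_ge_atTop C] with C' hC' x
    exact (hC x).trans (mul_le_mul_of_nonneg_right hC'
      (Finset.sum_nonneg fun i _ => mul_self_nonneg (x i)))
  have hull_le (k : ℕ) (hk : k < N) (T) (hT : T ∈ hull k) (x : Fin n → ℝ) :
      x ⬝ᵥ T *ᵥ x ≤ C * (x ⬝ᵥ x) := by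
    refine convexHull_min (t := {T | x ⬝ᵥ T *ᵥ x ≤ C * (x ⬝ᵥ x)})
      (Set.range_subset_iff.2 fun w => hC ⟨k, hk⟩ w x) (convex_halfSpace_le ⟨?_, ?_⟩ _) hT
    · intro A B; rw [add_mulVec, dotProduct_add]
    · intro c A; rw [smul_mulVec, dotProduct_smul]
  have hull_constraint (k : ℕ) (hk : k < N) (T) (hT : T ∈ hull k) (y : Fin n → ℝ) (j : Fin q) :
      2 * ((F * G + E * L) *ᵥ y) j + y ⬝ᵥ T *ᵥ y ≤ 1 + 2 * (y ⬝ᵥ G *ᵥ y) := by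
    rw [← le_sub_iff_add_le']
    refine convexHull_min
      (t := {T | y ⬝ᵥ T *ᵥ y ≤ 1 + 2 * (y ⬝ᵥ G *ᵥ y) - 2 * ((F * G + E * L) *ᵥ y) j})
      (Set.range_subset_iff.2 fun w => ?_) (convex_halfSpace_le ⟨?_, ?_⟩ _) hT
    · have h := (h3 k hk w).dotProduct_mulVec_nonneg
        (Sum.elim (-Pi.single j 1) y : Fin q ⊕ Fin n → ℝ)
      have hB := sumElim_dotProduct_fromBlocks_mulVec_sumElim (H k w) (F * G + E * L)ᵀ
        (Gᵀ + G - S k w) (-Pi.single j 1) y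
      have hj : y ⬝ᵥ (F * G + E * L)ᵀ *ᵥ Pi.single j 1 = ((F * G + E * L) *ᵥ y) j := by
        rw [mulVec_transpose, dotProduct_comm, ← dotProduct_mulVec, single_one_dotProduct]
      rw [transpose_transpose] at hB
      rw [star_trivial, hB, dotProduct_transpose_add_sub_mulVec, mulVec_neg, mulVec_neg,
        dotProduct_neg, neg_dotProduct, dotProduct_neg, hj, single_one_dotProduct,
        mulVec_single_one, col_apply] at h
      have := h4 k hk w j
      simp only [Set.mem_ofPred_eq]
      linarith
    · intro A B; rw [add_mulVec, dotProduct_add]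
    · intro c A; rw [smul_mulVec, dotProduct_smul]
  -- one step of the closed loop moves the hull at depth `k` into the next one
  have hull_step (α : Fin d → ℝ) (hα : ∀ i, 0 ≤ α i) (hα1 : ∑ i, α i = 1) (k : ℕ) (hk : k < N)
      (T) (hT : T ∈ hull k) : ∃ T' ∈ hull (if k + 1 < N then k + 1 else 0),
        DilatedLyapunov G (1 - δ) (∑ i, α i • M i) T T' := by
    refine DilatedLyapunov.exists_of_mem_convexHull (convex_convexHull ℝ _) ?_ hT
    rintro _ ⟨w, rfl⟩
    refine ⟨_, ?_, DilatedLyapunov.sum hα hα1 fun i => hδ ⟨k, hk⟩ w i⟩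
    refine (convex_convexHull ℝ _).sum_mem (fun i _ => hα i) hα1 fun i _ => ?_
    change _ ∈ hull _
    by_cases hk' : k + 1 < N
    · simp only [hk', if_true]
      exact subset_convexHull ℝ _ ⟨_, rfl⟩
    · simpa only [hk', if_false] using mem_hull_zero
  have hcl (α : Fin d → ℝ) (y : Fin n → ℝ) : ((∑ i, α i • Abar i) +
      (∑ i, α i • Bbar i) * (L * G⁻¹)) *ᵥ (G *ᵥ y) = (∑ i, α i • M i) *ᵥ y := by
    rw [mulVec_mulVec]
    congr 1
    rw [add_mul, Matrix.mul_assoc _ _ G, Matrix.mul_assoc L, nonsing_inv_mul _ hGdet, Matrix.mul_one]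
    simp only [hM, Finset.sum_mul, smul_add, Finset.sum_add_distrib, smul_mul, Matrix.sum_mul,
      Matrix.smul_mul]
  have decay (α : ℕ → Fin d → ℝ) (hα : ∀ t i, 0 ≤ α t i) (hα1 : ∀ t, ∑ i, α t i = 1)
      (x : ℕ → Fin n → ℝ) (hx : ∀ t, x (t + 1) =
        ((∑ i, α t i • Abar i) + (∑ i, α t i • Bbar i) * (L * G⁻¹)) *ᵥ x t) (t : ℕ) :
      ∃ T ∈ hull (t % N), x t ⬝ᵥ T⁻¹ *ᵥ x t ≤
        (1 - δ) ^ t * (x 0 ⬝ᵥ (S 0 Fin.elim0)⁻¹ *ᵥ x 0) := by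
    induction t with
    | zero => exact ⟨_, by simpa using mem_hull_zero, by simp⟩
    | succ t ih =>
      obtain ⟨T, hT, hle⟩ := ih
      have hk : t % N < N := Nat.mod_lt _ hN
      obtain ⟨T', hT', hL⟩ := hull_step (α t) (hα t) (hα1 t) _ hk T hT
      have hnext : (if t % N + 1 < N then t % N + 1 else 0) = (t + 1) % N := by
        rw [Nat.add_mod_eq_add_mod_right 1 (Nat.mod_mod t N).symm]
        split_ifs with h
        · exact (Nat.mod_eq_of_lt h).symm
        · rw [show t % N + 1 = N by omega, Nat.mod_self]
      rw [hnext] at hT'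
      refine ⟨T', hT', ?_⟩
      have h := hL.inv_le (by linarith) (hull_posDef _ hk T hT)
        (hull_posDef _ (Nat.mod_lt _ hN) T' hT') (G⁻¹ *ᵥ x t)
      rw [← hcl, hGinv, ← hx] at h
      rw [pow_succ', mul_assoc]
      exact h.trans (mul_le_mul_of_nonneg_left hle (by linarith))
  refine ⟨hG, fun α hα hα1 x hx hx0 => ?_, ?_⟩
  · have hle (t : ℕ) : ∃ T ∈ hull (t % N), x t ⬝ᵥ T⁻¹ *ᵥ x t ≤ 1 := by
      obtain ⟨T, hT, h⟩ := decay α hα hα1 x hx t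
      have hp : (1 - δ) ^ t ≤ 1 := pow_le_one₀ (by linarith) (by linarith)
      have hp0 : 0 ≤ (1 - δ) ^ t := pow_nonneg (by linarith) _
      exact ⟨T, hT, by nlinarith⟩
    refine ⟨fun t j => ?_, ?_⟩
    · obtain ⟨T, hT, h⟩ := hle t
      have hk : t % N < N := Nat.mod_lt _ hN
      have hc := hull_constraint _ hk T hT (G⁻¹ *ᵥ x t) j
      have hf := two_mul_dotProduct_sub_le_inv (hull_posDef _ hk T hT) (G⁻¹ *ᵥ x t) (x t)
      have hu : (F * G + E * L) *ᵥ (G⁻¹ *ᵥ x t) = F *ᵥ x t + E *ᵥ ((L * G⁻¹) *ᵥ x t) := by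
        rw [add_mulVec, ← mulVec_mulVec, hGinv, mulVec_mulVec, mulVec_mulVec, Matrix.mul_assoc]
      rw [hGinv, hu] at hc
      linarith
    · obtain ⟨T, hT, h⟩ := hle N
      rw [Nat.mod_self] at hT
      rwa [hull_zero T hT] at h
  · obtain ⟨C', hC'0, hC'⟩ := exists_dotProduct_mulVec_le (S 0 Fin.elim0)⁻¹
    refine ⟨max 1 √(C * C'), le_max_left _ _, √(1 - δ), ⟨Real.sqrt_pos.2 (by linarith), ?_⟩,
      fun α hα hα1 x hx _ t => ?_⟩
    · rw [Real.sqrt_lt' one_pos]; linarith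
    obtain ⟨T, hT, h⟩ := decay α hα hα1 x hx t
    have hk : t % N < N := Nat.mod_lt _ hN
    have hp : 0 ≤ (1 - δ) ^ t := pow_nonneg (by linarith) _
    have hbound : x t ⬝ᵥ x t ≤ C * C' * (1 - δ) ^ t * (x 0 ⬝ᵥ x 0) :=
      calc x t ⬝ᵥ x t ≤ C * (x t ⬝ᵥ T⁻¹ *ᵥ x t) :=
            dotProduct_self_le_of_inv (hull_posDef _ hk T hT) hC0 (hull_le _ hk T hT) _
        _ ≤ C * ((1 - δ) ^ t * (C' * (x 0 ⬝ᵥ x 0))) := by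
            have := mul_le_mul_of_nonneg_left (hC' (x 0)) hp
            gcongr
            exact h.trans this
        _ = _ := by ring
    simp only [eNorm_eq_sqrt_dotProduct]
    calc √(x t ⬝ᵥ x t) ≤ √(C * C' * (1 - δ) ^ t * (x 0 ⬝ᵥ x 0)) := Real.sqrt_le_sqrt hbound
      _ = √(C * C') * √(1 - δ) ^ t * √(x 0 ⬝ᵥ x 0) := by
          rw [Real.sqrt_mul (by positivity), Real.sqrt_mul (by positivity)]
          congr 2
          rw [Real.sqrt_eq_iff_mul_self_eq hp (by positivity), ← mul_pow,
            Real.mul_self_sqrt (by linarith)]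
      _ ≤ max 1 √(C * C') * √(1 - δ) ^ t * √(x 0 ⬝ᵥ x 0) := by
          gcongr
          exact le_max_right _ _
end
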